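/- arXiv:2511.08984 — 3 statements merged into one kernel-verified Lean document; each statement's English description precedes it below -/
import Mathlib

section
/- Members of the new rational Littlewood–Paley wavelet family with different band indices are orthogonal: if m₁ ≠ m₂ are integers with 1 ≤ m₁, m₂ ≤ p − q, then ⟨ψ^{m₁}_{j,n}, ψ^{m₂}_{l,k}⟩_{L²(ℝ)} = 0 for all integers j, l, n, k. -/
open MeasureTheory Real ComplexConjugate Filter Topology

noncomputable section

/-- The rational dilation factor `M = p / q`. -/
def Mdil (p q : ℕ) : ℝ := (p : ℝ) / (q : ℝ)

/-- The Fourier transform of the new rational Littlewood–Paley wavelet: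
`√q` on `{ω : (q+m-1)π/q ≤ |ω| < (q+m)π/q}` and `0` elsewhere. -/
def newHat (q m : ℕ) (ω : ℝ) : ℂ :=
  if ((q : ℝ) + (m : ℝ) - 1) * π / (q : ℝ) ≤ |ω| ∧ |ω| < ((q : ℝ) + (m : ℝ)) * π / (q : ℝ)
  then ((Real.sqrt q : ℝ) : ℂ) else 0

/-- The Fourier transform of Auscher's rational Littlewood–Paley wavelet:
`1` on `{ω : (q+m-1)π/q ≤ |ω| < (q+m)π/q}` and `0` elsewhere. -/
def auscherHat (q m : ℕ) (ω : ℝ) : ℂ :=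
  if ((q : ℝ) + (m : ℝ) - 1) * π / (q : ℝ) ≤ |ω| ∧ |ω| < ((q : ℝ) + (m : ℝ)) * π / (q : ℝ)
  then 1 else 0

/-- The inverse Fourier transform `t ↦ (1/(2π)) ∫ g(ω) e^{iωt} dω`
(for the convention `ĝ(ω) = ∫ g(x) e^{-iωx} dx`). -/
def invFT (g : ℝ → ℂ) (t : ℝ) : ℂ :=
  ((1 / (2 * π) : ℝ) : ℂ) * ∫ ω : ℝ, g ω * Complex.exp (Complex.I * (ω : ℂ) * (t : ℂ))

/-- The new rational Littlewood–Paley wavelet `ψ^m` in the time domain. -/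
def newPsi (q m : ℕ) : ℝ → ℂ := invFT (newHat q m)

/-- Auscher's rational Littlewood–Paley wavelet `ψ^m` in the time domain. -/
def auscherPsi (q m : ℕ) : ℝ → ℂ := invFT (auscherHat q m)

/-- The dilate–translate `x ↦ M^{-j/2} f (M^{-j} x - n q)`. -/
def dilTrans (p q : ℕ) (j n : ℤ) (f : ℝ → ℂ) : ℝ → ℂ := fun x =>
  ((Mdil p q ^ (-(j : ℝ) / 2) : ℝ) : ℂ) * f (Mdil p q ^ (-j) * x - (n : ℝ) * (q : ℝ))

/-- `ψ^m_{j,n}(x) = M^{-j/2} ψ^m (M^{-j} x - n q)` for the new wavelet. -/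
def psiJN (p q m : ℕ) (j n : ℤ) : ℝ → ℂ := dilTrans p q j n (newPsi q m)

/-- `ψ^m_{j,n}(x) = M^{-j/2} ψ^m (M^{-j} x - n q)` for Auscher's wavelet. -/
def auscherJN (p q m : ℕ) (j n : ℤ) : ℝ → ℂ := dilTrans p q j n (auscherPsi q m)

/-- The `L²` inner product `⟨f, g⟩ = ∫ f ḡ`. -/
def innerL2 (f g : ℝ → ℂ) : ℂ := ∫ x : ℝ, f x * conj (g x)

/-- The frequency band `{ω : M^{-j}(q+m-1)π/q ≤ |ω| < M^{-j}(q+m)π/q}`. -/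
def bandJ (p q m : ℕ) (j : ℤ) : Set ℝ :=
  {ω : ℝ | Mdil p q ^ (-j) * (((q : ℝ) + (m : ℝ) - 1) * π / (q : ℝ)) ≤ |ω| ∧
           |ω| < Mdil p q ^ (-j) * (((q : ℝ) + (m : ℝ)) * π / (q : ℝ))}

/-- The scale annulus `{ω : M^{-j}π ≤ |ω| < M^{-j+1}π}`. -/
def annulus (p q : ℕ) (j : ℤ) : Set ℝ :=
  {ω : ℝ | Mdil p q ^ (-j) * π ≤ |ω| ∧ |ω| < Mdil p q ^ (-j + 1) * π}

open FourierTransform in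
/-- On `L¹ ∩ L²`, the `L²` Fourier transform agrees with the Fourier integral. -/
theorem coeFn_fourier_toLp {f : ℝ → ℂ} (hf : Integrable f) (hf₂ : MemLp f 2) :
    (𝓕 (hf₂.toLp f) : Lp ℂ 2 (volume : Measure ℝ)) =ᵐ[volume] 𝓕 f := by
  have hcont : Continuous (𝓕 f) :=
    VectorFourier.fourierIntegral_continuous Real.continuous_fourierChar
      (by exact continuous_inner) hf
  refine ae_eq_of_integral_contDiff_smul_eq
    ((Lp.memLp _).locallyIntegrable (by norm_num)) hcont.locallyIntegrable ?_
  intro g g_smooth g_cpt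
  have hg₁ : HasCompactSupport (Complex.ofRealCLM ∘ g) := g_cpt.comp_left rfl
  have hg₂ := Complex.ofRealCLM.contDiff.comp g_smooth
  have key := DFunLike.congr_fun (Lp.fourier_toTemperedDistribution_eq (hf₂.toLp f))
    (hg₁.toSchwartzMap hg₂)
  rw [TemperedDistribution.fourier_apply, Lp.toTemperedDistribution_apply,
    Lp.toTemperedDistribution_apply] at key
  have h₁ : ∫ x, (𝓕 (hg₁.toSchwartzMap hg₂)) x • (hf₂.toLp f) x
      = ∫ x, (𝓕 (hg₁.toSchwartzMap hg₂)) x • f x := by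
    refine integral_congr_ae ?_
    filter_upwards [hf₂.coeFn_toLp] with x hx
    rw [hx]
  rw [h₁, SchwartzMap.fourier_coe] at key
  have h₂ : ∫ x, 𝓕 (hg₁.toSchwartzMap hg₂ : ℝ → ℂ) x • f x =
      ∫ x, (hg₁.toSchwartzMap hg₂) x • 𝓕 f x := by
    have h := VectorFourier.integral_fourierIntegral_smul_eq_flip (L := innerₗ ℝ)
      (μ := volume) (ν := volume) Real.continuous_fourierChar continuous_inner
      (hg₁.toSchwartzMap hg₂).integrable hf
    rwa [flip_innerₗ] at h
  rw [h₂] at key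
  simpa using key.symm

open FourierTransform in
/-- Plancherel's theorem for the Fourier integral on `L¹ ∩ L²`. -/
theorem innerL2_fourier_eq {f g : ℝ → ℂ} (hf : Integrable f) (hf₂ : MemLp f 2)
    (hg : Integrable g) (hg₂ : MemLp g 2) : innerL2 (𝓕 f) (𝓕 g) = innerL2 f g := by
  have key := Lp.inner_fourier_eq (hg₂.toLp g) (hf₂.toLp f)
  rw [L2.inner_def, L2.inner_def] at key
  unfold innerL2
  calc _ = _ := integral_congr_ae ?_
    _ = _ := key
    _ = _ := integral_congr_ae ?_
  · filter_upwards [coeFn_fourier_toLp hf hf₂, coeFn_fourier_toLp hg hg₂] with x h₁ h₂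
    simp [h₁, h₂]
  · filter_upwards [hf₂.coeFn_toLp, hg₂.coeFn_toLp] with x h₁ h₂
    simp [h₁, h₂]

open FourierTransform in
theorem invFT_eq_fourier (g : ℝ → ℂ) (t : ℝ) :
    invFT g t = ((1 / (2 * π) : ℝ) : ℂ) * 𝓕 g (-(2 * π)⁻¹ * t) := by
  unfold invFT
  rw [Real.fourier_real_eq_integral_exp_smul]
  congr 2
  ext ω
  rw [smul_eq_mul, mul_comm]
  congr 2
  push_cast
  field_simp

theorem innerL2_invFT_eq_zero {f g : ℝ → ℂ} (hf : Integrable f) (hf₂ : MemLp f 2)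
    (hg : Integrable g) (hg₂ : MemLp g 2) (hfg : innerL2 f g = 0) :
    innerL2 (invFT f) (invFT g) = 0 := by
  rw [← innerL2_fourier_eq hf hf₂ hg hg₂] at hfg
  unfold innerL2 at hfg ⊢
  simp_rw [invFT_eq_fourier, map_mul, mul_mul_mul_comm]
  rw [integral_const_mul, Measure.integral_comp_mul_left
    (fun t => FourierTransform.fourier f t * conj (FourierTransform.fourier g t)), hfg]
  simp

/-- Dilation and translation in time is dilation and modulation in frequency. -/
theorem dilTrans_invFT {p q : ℕ} (hM : 0 < Mdil p q) (j n : ℤ) (g : ℝ → ℂ) :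
    dilTrans p q j n (invFT g) = invFT fun ω =>
      ((Mdil p q ^ (-(j : ℝ) / 2) * Mdil p q ^ j : ℝ) : ℂ) * (g (Mdil p q ^ j * ω) *
        Complex.exp (((-(Mdil p q ^ j * ω * (n * q)) : ℝ) : ℂ) * Complex.I)) := by
  have hu : 0 < Mdil p q ^ j := zpow_pos hM j
  ext x
  unfold dilTrans invFT
  have h := Measure.integral_comp_mul_left (fun ω : ℝ => g ω *
    Complex.exp (Complex.I * (ω : ℂ) * ((Mdil p q ^ (-j) * x - n * q : ℝ) : ℂ))) (Mdil p q ^ j)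
  rw [abs_of_pos (inv_pos.2 hu), eq_inv_smul_iff₀ hu.ne', Complex.real_smul] at h
  rw [← h, mul_left_comm, ← mul_assoc _ _ (integral _ _), ← Complex.ofReal_mul,
    ← integral_const_mul]
  refine congrArg _ (integral_congr_ae (Eventually.of_forall fun ω => ?_))
  beta_reduce
  rw [mul_assoc (Complex.ofReal _), mul_assoc (g _), ← Complex.exp_add]
  congr 3
  rw [zpow_neg]
  have : ((Mdil p q ^ j : ℝ) : ℂ) ≠ 0 := Complex.ofReal_ne_zero.2 hu.ne'
  generalize Mdil p q ^ j = u at this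
  push_cast
  field_simp
  ring

/-- The frequency-side description of `ψ^m_{j,n}` is supported in the band of index `m`
at scale `j`. -/
theorem psiJN_eq_invFT {p q : ℕ} (hM : 0 < Mdil p q) (m : ℕ) (j n : ℤ) :
    ∃ F : ℝ → ℂ, Continuous F ∧ (∃ C, ∀ ω, ‖F ω‖ ≤ C) ∧
      psiJN p q m j n = invFT ((bandJ p q m j).indicator F) := by
  have hu : 0 < Mdil p q ^ j := zpow_pos hM j
  refine ⟨fun ω => ((Mdil p q ^ (-(j : ℝ) / 2) * Mdil p q ^ j : ℝ) : ℂ) *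
    (((Real.sqrt q : ℝ) : ℂ) *
      Complex.exp (((-(Mdil p q ^ j * ω * (n * q)) : ℝ) : ℂ) * Complex.I)),
    by fun_prop, ⟨‖((Mdil p q ^ (-(j : ℝ) / 2) * Mdil p q ^ j : ℝ) : ℂ)‖ *
      ‖((Real.sqrt q : ℝ) : ℂ)‖, fun ω => ?_⟩, ?_⟩
  · rw [norm_mul, norm_mul, Complex.norm_exp_ofReal_mul_I, mul_one]
  · rw [psiJN, newPsi, dilTrans_invFT hM]
    congr 1
    ext ω
    have hiff : ω ∈ bandJ p q m j ↔
        ((q : ℝ) + (m : ℝ) - 1) * π / (q : ℝ) ≤ |Mdil p q ^ j * ω| ∧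
          |Mdil p q ^ j * ω| < ((q : ℝ) + (m : ℝ)) * π / (q : ℝ) := by
      rw [bandJ, Set.mem_ofPred_eq, zpow_neg, abs_mul, abs_of_pos hu, inv_mul_le_iff₀ hu,
        lt_inv_mul_iff₀ hu]
    by_cases h : ω ∈ bandJ p q m j
    · rw [Set.indicator_of_mem h, newHat, if_pos (hiff.1 h)]
    · rw [Set.indicator_of_notMem h, newHat, if_neg (mt hiff.2 h)]
      simp

theorem measurableSet_bandJ (p q m : ℕ) (j : ℤ) : MeasurableSet (bandJ p q m j) :=
  (measurableSet_le measurable_const continuous_abs.measurable).inter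
    (measurableSet_lt continuous_abs.measurable measurable_const)

theorem volume_bandJ_lt_top (p q m : ℕ) (j : ℤ) : volume (bandJ p q m j) < ⊤ := by
  refine (Metric.isBounded_closedBall (x := (0 : ℝ))
    (r := Mdil p q ^ (-j) * (((q : ℝ) + (m : ℝ)) * π / (q : ℝ)))).subset ?_ |>.measure_lt_top
  intro ω hω
  simpa using hω.2.le

theorem memLp_indicator_bandJ (p q m : ℕ) (j : ℤ) {F : ℝ → ℂ} (hF : Continuous F)
    {C : ℝ} (hC : ∀ ω, ‖F ω‖ ≤ C) (r : ENNReal) :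
    MemLp ((bandJ p q m j).indicator F) r := by
  rw [memLp_indicator_iff_restrict (measurableSet_bandJ p q m j)]
  have : IsFiniteMeasure (volume.restrict (bandJ p q m j)) :=
    ⟨by simpa using volume_bandJ_lt_top p q m j⟩
  exact MemLp.of_bound hF.aestronglyMeasurable C (Eventually.of_forall hC)

theorem bandJ_subset_annulus {p q m : ℕ} (hq : 1 ≤ q) (hm : 1 ≤ m) (hm' : q + m ≤ p) (j : ℤ) :
    bandJ p q m j ⊆ annulus p q j := by
  have hq' : (0 : ℝ) < q := by exact_mod_cast hq
  have hmR : (1 : ℝ) ≤ m := by exact_mod_cast hm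
  have hpR : (q : ℝ) + m ≤ p := by exact_mod_cast hm'
  have hM : 0 < Mdil p q := div_pos (by linarith) hq'
  intro ω hω
  refine ⟨le_trans ?_ hω.1, hω.2.trans_le ?_⟩
  · have : π ≤ ((q : ℝ) + m - 1) * π / q := by
      rw [le_div_iff₀ hq']; nlinarith [pi_pos]
    gcongr
  · rw [zpow_add_one₀ hM.ne', mul_assoc]
    have : ((q : ℝ) + m) * π / q ≤ Mdil p q * π := by
      rw [Mdil, div_mul_eq_mul_div]; gcongr
    gcongr

theorem disjoint_annulus_of_lt {p q : ℕ} (hM : 1 ≤ Mdil p q) {j l : ℤ} (h : j < l) :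
    Disjoint (annulus p q j) (annulus p q l) := by
  rw [Set.disjoint_left]
  intro ω hj hl
  have : Mdil p q ^ (-l + 1) ≤ Mdil p q ^ (-j) := zpow_le_zpow_right₀ hM (by omega)
  have := mul_le_mul_of_nonneg_right this pi_pos.le
  linarith [hj.1, hl.2]

theorem disjoint_bandJ_of_lt {p q m₁ m₂ : ℕ} (j : ℤ) (h : m₁ < m₂) :
    Disjoint (bandJ p q m₁ j) (bandJ p q m₂ j) := by
  rw [Set.disjoint_left]
  intro ω h₁ h₂
  have hmR : (m₁ : ℝ) + 1 ≤ m₂ := by exact_mod_cast h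
  have : Mdil p q ^ (-j) * (((q : ℝ) + m₁) * π / q) ≤
      Mdil p q ^ (-j) * (((q : ℝ) + m₂ - 1) * π / q) := by
    have : 0 ≤ Mdil p q := by unfold Mdil; positivity
    have : (q : ℝ) + m₁ ≤ q + m₂ - 1 := by linarith
    gcongr
  linarith [h₁.2, h₂.1]

theorem disjoint_bandJ {p q m₁ m₂ : ℕ} (hq : 1 ≤ q) (hm : m₁ ≠ m₂)
    (hm₁ : 1 ≤ m₁) (hm₁' : q + m₁ ≤ p) (hm₂ : 1 ≤ m₂) (hm₂' : q + m₂ ≤ p) (j l : ℤ) :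
    Disjoint (bandJ p q m₁ j) (bandJ p q m₂ l) := by
  have hM : 1 ≤ Mdil p q := by
    rw [Mdil, one_le_div (by exact_mod_cast hq)]
    exact_mod_cast (by omega : q ≤ p)
  have s₁ := bandJ_subset_annulus hq hm₁ hm₁' j
  have s₂ := bandJ_subset_annulus hq hm₂ hm₂' l
  rcases lt_trichotomy j l with h | rfl | h
  · exact (disjoint_annulus_of_lt hM h).mono s₁ s₂
  · rcases hm.lt_or_gt with h | h
    · exact disjoint_bandJ_of_lt j h
    · exact (disjoint_bandJ_of_lt j h).symm
  · exact (disjoint_annulus_of_lt hM h).symm.mono s₁ s₂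

/-- members of the new rational Littlewood–Paley wavelet family with different
band indices are orthogonal. -/
theorem newPsi_orthogonal_of_ne_band (p q : ℕ) (hco : Nat.Coprime p q)
    (hq : 1 ≤ q) (hpq : q < p) (m₁ m₂ : ℕ) (hm : m₁ ≠ m₂)
    (hm₁ : 1 ≤ m₁) (hm₁' : m₁ ≤ p - q) (hm₂ : 1 ≤ m₂) (hm₂' : m₂ ≤ p - q)
    (j l n k : ℤ) :
    innerL2 (psiJN p q m₁ j n) (psiJN p q m₂ l k) = 0 := by
  have hM : 0 < Mdil p q :=
    div_pos (by exact_mod_cast (by omega : 0 < p)) (by exact_mod_cast hq)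
  obtain ⟨F, hF, ⟨C, hC⟩, hFeq⟩ := psiJN_eq_invFT hM m₁ j n
  obtain ⟨G, hG, ⟨D, hD⟩, hGeq⟩ := psiJN_eq_invFT hM m₂ l k
  rw [hFeq, hGeq]
  refine innerL2_invFT_eq_zero
    (memLp_one_iff_integrable.1 (memLp_indicator_bandJ p q m₁ j hF hC 1))
    (memLp_indicator_bandJ p q m₁ j hF hC 2)
    (memLp_one_iff_integrable.1 (memLp_indicator_bandJ p q m₂ l hG hD 1))
    (memLp_indicator_bandJ p q m₂ l hG hD 2) ?_
  refine integral_eq_zero_of_ae (Eventually.of_forall fun ω => ?_)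
  have hdisj := disjoint_bandJ hq hm hm₁ (by omega) hm₂ (by omega : q + m₂ ≤ p) j l
  by_cases h : ω ∈ bandJ p q m₁ j
  · simp [Set.indicator_of_notMem (Set.disjoint_left.1 hdisj h)]
  · simp [Set.indicator_of_notMem h]
end
end

section
/- Within a fixed scale and band, distinct translates of the new rational Littlewood–Paley wavelet are orthogonal: for every integer j, every integer m with 1 ≤ m ≤ p − q, and all integers n ≠ k, ⟨ψ^m_{j,n}, ψ^m_{j,k}⟩_{L²(ℝ)} = 0. -/
open MeasureTheory Real ComplexConjugate Filter Topology

noncomputable section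

open FourierTransform in
/-- On `L¹ ∩ L²`, the `L²` Fourier transform is given by the Fourier integral. -/
theorem coeFn_fourier_toLp_ae_eq {f : ℝ → ℂ} (hf : Integrable f) (hf2 : MemLp f 2) :
    (𝓕 (hf2.toLp f) : Lp ℂ 2 (volume : Measure ℝ)) =ᵐ[volume] 𝓕 f := by
  have hcont : Continuous (𝓕 f) :=
    VectorFourier.fourierIntegral_continuous Real.continuous_fourierChar
      (L := innerₗ ℝ) continuous_inner hf
  apply ae_eq_of_integral_contDiff_smul_eq
  · exact (Lp.memLp _).locallyIntegrable (by norm_num)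
  · exact hcont.locallyIntegrable
  · intro g g_smooth g_cpt
    have hg₁ : HasCompactSupport (Complex.ofRealCLM ∘ g) := g_cpt.comp_left (by simp)
    have hg₂ : ContDiff ℝ (⊤ : ℕ∞) (Complex.ofRealCLM ∘ g) :=
      Complex.ofRealCLM.contDiff.comp g_smooth
    set u : SchwartzMap ℝ ℂ := hg₁.toSchwartzMap hg₂ with hu
    have hug (x : ℝ) : u x = (g x : ℂ) := by simp [hu]
    have key := congrArg (fun T => T u) (Lp.fourier_toTemperedDistribution_eq (hf2.toLp f))
    simp only [TemperedDistribution.fourier_apply, Lp.toTemperedDistribution_apply] at key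
    have hflip := VectorFourier.integral_bilin_fourierIntegral_eq_flip
      (ContinuousLinearMap.mul ℂ ℂ) (L := innerₗ ℝ) Real.continuous_fourierChar
      continuous_inner (u.integrable (μ := volume)) hf
    calc ∫ x, g x • (𝓕 (hf2.toLp f) : Lp ℂ 2 (volume : Measure ℝ)) x
        = ∫ x, u x • (𝓕 (hf2.toLp f) : Lp ℂ 2 (volume : Measure ℝ)) x := by
          simp [hug]
      _ = ∫ x, 𝓕 u x • (hf2.toLp f : ℝ → ℂ) x := key.symm
      _ = ∫ x, 𝓕 u x * f x := by
          apply integral_congr_ae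
          filter_upwards [hf2.coeFn_toLp] with x hx
          rw [hx, smul_eq_mul]
      _ = ∫ x, u x * 𝓕 f x := by
          simpa [SchwartzMap.fourier_coe] using! hflip
      _ = ∫ x, g x • 𝓕 f x := by simp [hug]

open FourierTransform in
/-- Plancherel's theorem on `L¹ ∩ L²`, for the Fourier integral. -/
theorem integral_fourier_mul_conj_fourier {f g : ℝ → ℂ} (hf : Integrable f) (hf2 : MemLp f 2)
    (hg : Integrable g) (hg2 : MemLp g 2) :
    ∫ x, 𝓕 f x * conj (𝓕 g x) = ∫ x, f x * conj (g x) := by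
  have h := Lp.inner_fourier_eq (hg2.toLp g) (hf2.toLp f)
  rw [L2.inner_def, L2.inner_def] at h
  calc ∫ x, 𝓕 f x * conj (𝓕 g x)
      = ∫ x, inner ℂ ((𝓕 (hg2.toLp g) : Lp ℂ 2 (volume : Measure ℝ)) x)
          ((𝓕 (hf2.toLp f) : Lp ℂ 2 (volume : Measure ℝ)) x) := by
        apply integral_congr_ae
        filter_upwards [coeFn_fourier_toLp_ae_eq hf hf2, coeFn_fourier_toLp_ae_eq hg hg2]
          with x h1 h2
        rw [h1, h2, RCLike.inner_apply]
    _ = ∫ x, inner ℂ (hg2.toLp g x) (hf2.toLp f x) := h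
    _ = ∫ x, f x * conj (g x) := by
        apply integral_congr_ae
        filter_upwards [hf2.coeFn_toLp, hg2.coeFn_toLp] with x h1 h2
        rw [h1, h2, RCLike.inner_apply]

open FourierTransform in
theorem invFT_eq_fourier_s7 (f : ℝ → ℂ) : invFT f = 𝓕 (fun v => f (-(2 * π) * v)) := by
  ext t
  have h := Measure.integral_comp_mul_left
    (fun ω : ℝ => f ω * Complex.exp (Complex.I * (ω : ℂ) * (t : ℂ))) (-(2 * π))
  have habs : |(-(2 * π))⁻¹| = 1 / (2 * π) := by
    rw [abs_inv, abs_neg, abs_of_pos Real.two_pi_pos, one_div]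
  rw [habs, Complex.real_smul] at h
  rw [invFT, ← h, Real.fourier_eq']
  congr with v
  rw [smul_eq_mul, mul_comm]
  congr 2
  simp
  ring

/-- Plancherel's theorem on `L¹ ∩ L²`, for the inverse Fourier integral `invFT`. -/
theorem integral_invFT_mul_conj_invFT {f g : ℝ → ℂ} (hf : Integrable f) (hf2 : MemLp f 2)
    (hg : Integrable g) (hg2 : MemLp g 2) :
    ∫ x, invFT f x * conj (invFT g x) =
      ((1 / (2 * π) : ℝ) : ℂ) * ∫ ω, f ω * conj (g ω) := by
  have hne : (-(2 * π)) ≠ 0 := neg_ne_zero.mpr Real.two_pi_pos.ne'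
  have memLp_comp {f : ℝ → ℂ} (hf2 : MemLp f 2) : MemLp (fun v => f (-(2 * π) * v)) 2 := by
    have hmap := Real.map_volume_mul_left hne
    have : MemLp f 2 (Measure.map (fun v => -(2 * π) * v) volume) := by
      rw [hmap]
      exact hf2.smul_measure ENNReal.ofReal_ne_top
    exact this.comp_of_map (by fun_prop)
  rw [invFT_eq_fourier_s7, invFT_eq_fourier_s7,
    integral_fourier_mul_conj_fourier (hf.comp_mul_left' hne) (memLp_comp hf2)
      (hg.comp_mul_left' hne) (memLp_comp hg2),
    Measure.integral_comp_mul_left (fun ω : ℝ => f ω * conj (g ω)) (-(2 * π)),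
    abs_inv, abs_neg, abs_of_pos Real.two_pi_pos, one_div, Complex.real_smul]

theorem invFT_sub (f : ℝ → ℂ) (x s : ℝ) :
    invFT f (x - s) = invFT (fun ω => f ω * Complex.exp (-(Complex.I * ω * s))) x := by
  simp only [invFT]
  congr 2 with ω
  rw [mul_assoc (f ω), ← Complex.exp_add]
  congr 2
  push_cast
  ring

/-- A symmetric pair of half-open intervals, as a set of real numbers. -/
theorem setOf_le_abs_and_abs_lt {a b : ℝ} (ha : 0 < a) :
    {ω : ℝ | a ≤ |ω| ∧ |ω| < b} = Set.Ico a b ∪ Set.Ioc (-b) (-a) := by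
  ext ω
  simp only [Set.mem_ofPred_eq, Set.mem_union, Set.mem_Ico, Set.mem_Ioc]
  constructor
  · rintro ⟨h1, h2⟩
    rcases abs_cases ω with ⟨h, _⟩ | ⟨h, _⟩
    · left; constructor <;> linarith
    · right; constructor <;> linarith
  · rintro (⟨h1, h2⟩ | ⟨h1, h2⟩)
    · rw [abs_of_pos (by linarith)]; exact ⟨h1, h2⟩
    · rw [abs_of_neg (by linarith)]; constructor <;> linarith

theorem newHat_eq_indicator (q m : ℕ) :
    newHat q m = Set.indicator {ω : ℝ | ((q : ℝ) + (m : ℝ) - 1) * π / (q : ℝ) ≤ |ω| ∧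
      |ω| < ((q : ℝ) + (m : ℝ)) * π / (q : ℝ)} (fun _ => ((Real.sqrt q : ℝ) : ℂ)) := by
  ext ω
  simp [newHat, Set.indicator_apply]

/-- If `2ca` and `2cb` are integer multiples of `2πi`, then `exp (cω)` has mean zero over
`{ω : a ≤ |ω| < b}`. -/
theorem setIntegral_exp_eq_zero {a b : ℝ} (ha : 0 < a) (hab : a ≤ b) {c : ℂ} (hc : c ≠ 0)
    {A B : ℤ} (hA : c * a = A * (π * Complex.I)) (hB : c * b = B * (π * Complex.I)) :
    ∫ ω in {ω : ℝ | a ≤ |ω| ∧ |ω| < b}, Complex.exp (c * ω) = 0 := by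
  have hcont : Continuous (fun ω : ℝ => Complex.exp (c * ω)) := by fun_prop
  have hdisj : Disjoint (Set.Ico a b) (Set.Ioc (-b) (-a)) := by
    rw [Set.disjoint_left]
    rintro x ⟨h1, _⟩ ⟨_, h2⟩
    linarith
  have hexp {z : ℂ} {N : ℤ} (h : z = N * (π * Complex.I)) :
      Complex.exp z = Complex.exp (-z) := by
    rw [Complex.exp_eq_exp_iff_exists_int]
    exact ⟨N, by rw [h]; ring⟩
  rw [setOf_le_abs_and_abs_lt ha, setIntegral_union hdisj measurableSet_Ioc
    (hcont.integrableOn_Icc.mono_set Set.Ico_subset_Icc_self)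
    (hcont.integrableOn_Icc.mono_set Set.Ioc_subset_Icc_self),
    integral_Ico_eq_integral_Ioc, ← intervalIntegral.integral_of_le hab,
    ← intervalIntegral.integral_of_le (by linarith), integral_exp_mul_complex hc,
    integral_exp_mul_complex hc, ← add_div]
  push_cast
  rw [mul_neg, mul_neg, hexp hA, hexp hB]
  simp

theorem integral_newPsi_sub_mul_conj {q m : ℕ} (hq : 1 ≤ q) (hm : 1 ≤ m) {n k : ℤ}
    (hnk : n ≠ k) :
    ∫ x : ℝ, newPsi q m (x - n * q) * conj (newPsi q m (x - k * q)) = 0 := by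
  have hq0 : (0 : ℝ) < q := by exact_mod_cast hq
  have hm0 : (1 : ℝ) ≤ m := by exact_mod_cast hm
  set a : ℝ := ((q : ℝ) + (m : ℝ) - 1) * π / (q : ℝ) with ha_def
  set b : ℝ := ((q : ℝ) + (m : ℝ)) * π / (q : ℝ) with hb_def
  have ha : 0 < a := by
    have : 0 < (q : ℝ) + m - 1 := by linarith
    positivity
  have hab : a ≤ b := by
    rw [ha_def, hb_def]
    gcongr
    linarith
  set S : Set ℝ := {ω : ℝ | a ≤ |ω| ∧ |ω| < b} with hS_def
  have hS : MeasurableSet S := by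
    rw [hS_def, setOf_le_abs_and_abs_lt ha]
    exact measurableSet_Ico.union measurableSet_Ioc
  have hSfin : volume S ≠ ⊤ := by
    rw [hS_def, setOf_le_abs_and_abs_lt ha]
    exact (measure_union_lt_top measure_Ico_lt_top measure_Ioc_lt_top).ne
  have hhat : newHat q m = S.indicator (fun _ => ((Real.sqrt q : ℝ) : ℂ)) :=
    newHat_eq_indicator q m
  have hmem (s : ℝ) (r : ENNReal) :
      MemLp (fun ω : ℝ => newHat q m ω * Complex.exp (-(Complex.I * ω * s))) r := by
    have h0 : MemLp (newHat q m) r := by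
      rw [hhat]
      exact memLp_indicator_const r hS _ (Or.inr hSfin)
    refine h0.of_le (h0.aestronglyMeasurable.mul
      (by fun_prop : Continuous _).aestronglyMeasurable) (ae_of_all _ fun ω => ?_)
    simp [Complex.norm_exp]
  have hint (s : ℝ) := memLp_one_iff_integrable.mp (hmem s 1)
  simp_rw [newPsi, invFT_sub]
  rw [integral_invFT_mul_conj_invFT (hint _) (hmem _ 2) (hint _) (hmem _ 2)]
  set c : ℂ := Complex.I * ((k - n : ℤ) * q) with hc_def
  have hc : c ≠ 0 := by
    have h1 : ((k - n : ℤ) : ℂ) ≠ 0 := by exact_mod_cast sub_ne_zero.mpr hnk.symm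
    have h2 : (q : ℂ) ≠ 0 := by exact_mod_cast hq0.ne'
    exact mul_ne_zero Complex.I_ne_zero (mul_ne_zero h1 h2)
  have hfun (ω : ℝ) :
      newHat q m ω * Complex.exp (-(Complex.I * ω * ((n * q : ℝ) : ℂ))) *
        conj (newHat q m ω * Complex.exp (-(Complex.I * ω * ((k * q : ℝ) : ℂ)))) =
      S.indicator (fun ω : ℝ => (q : ℂ) * Complex.exp (c * ω)) ω := by
    rw [hhat]
    by_cases hω : ω ∈ S
    · simp only [Set.indicator_of_mem hω, map_mul, Complex.conj_ofReal, ← Complex.exp_conj]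
      rw [mul_mul_mul_comm, ← Complex.ofReal_mul, Real.mul_self_sqrt hq0.le, ← Complex.exp_add,
        Complex.ofReal_natCast]
      congr 2
      simp [hc_def]
      ring
    · simp [Set.indicator_of_notMem hω]
  have hqC : (q : ℂ) ≠ 0 := by exact_mod_cast hq0.ne'
  simp_rw [hfun]
  rw [integral_indicator hS, integral_const_mul,
    setIntegral_exp_eq_zero ha hab hc (A := (k - n) * (q + m - 1)) (B := (k - n) * (q + m)),
    mul_zero, mul_zero]
  · rw [hc_def, ha_def]
    push_cast
    field_simp
  · rw [hc_def, hb_def]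
    push_cast
    field_simp

/-- within a fixed scale and band, distinct translates of the new rational
Littlewood–Paley wavelet are orthogonal. -/
theorem newPsi_orthogonal_of_ne_translate (p q : ℕ) (hco : Nat.Coprime p q)
    (hq : 1 ≤ q) (hpq : q < p) (j : ℤ) (m : ℕ) (hm1 : 1 ≤ m) (hm2 : m ≤ p - q)
    (n k : ℤ) (hnk : n ≠ k) :
    innerL2 (psiJN p q m j n) (psiJN p q m j k) = 0 := by
  have h := Measure.integral_comp_mul_left (fun x : ℝ =>
    newPsi q m (x - n * q) * conj (newPsi q m (x - k * q))) (Mdil p q ^ (-j))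
  rw [integral_newPsi_sub_mul_conj hq hm1 hnk, smul_zero] at h
  simp only [innerL2, psiJN, dilTrans, map_mul]
  refine (integral_congr_ae (ae_of_all _ fun x => mul_mul_mul_comm _ _ _ _)).trans ?_
  rw [integral_const_mul, h, mul_zero]
end
end

section
/- The new rational Littlewood–Paley wavelet family is orthonormal in L²(ℝ): for all integers j, l, n, k and all integers m₁, m₂ with 1 ≤ m₁, m₂ ≤ p − q, ⟨ψ^{m₁}_{j,n}, ψ^{m₂}_{l,k}⟩_{L²(ℝ)} equals 1 if (j, m₁, n) = (l, m₂, k) and 0 otherwise. -/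
open MeasureTheory Real ComplexConjugate Filter Topology

noncomputable section

open scoped FourierTransform

/-- For `f ∈ L¹ ∩ L²`, the inverse Fourier integral agrees almost everywhere with the
`L²` inverse Fourier transform. -/
theorem coeFn_fourierInv_toLp_ae_eq {f : ℝ → ℂ} (hf : Integrable f) (hf2 : MemLp f 2) :
    (𝓕⁻ (hf2.toLp f) : Lp ℂ 2 (volume : Measure ℝ)) =ᵐ[volume] 𝓕⁻ f := by
  have hcont : Continuous (𝓕⁻ f) := by
    have h := VectorFourier.fourierIntegral_continuous (μ := volume) (f := f) (L := -innerₗ ℝ)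
      Real.continuous_fourierChar (continuous_inner (𝕜 := ℝ) (E := ℝ)).neg hf
    exact h
  refine ae_eq_of_integral_contDiff_smul_eq
    ((Lp.memLp _).locallyIntegrable (by norm_num)) hcont.locallyIntegrable fun g hg hgs => ?_
  have hgs' : HasCompactSupport (fun x => (g x : ℂ)) := hgs.comp_left (g := Complex.ofReal) rfl
  have hg' : ContDiff ℝ (⊤ : ℕ∞) (fun x => (g x : ℂ)) := Complex.ofRealCLM.contDiff.comp hg
  let G : SchwartzMap ℝ ℂ := hgs'.toSchwartzMap hg'
  have hG (x : ℝ) : G x = (g x : ℂ) := rfl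
  have key := congrArg (fun T : TemperedDistribution ℝ ℂ => T G)
    (Lp.fourierInv_toTemperedDistribution_eq (hf2.toLp f))
  simp only [TemperedDistribution.fourierInv_apply, Lp.toTemperedDistribution_apply, hG] at key
  have hflip : ∫ x : ℝ, (𝓕⁻ (G : ℝ → ℂ)) x • f x = ∫ x : ℝ, G x • 𝓕⁻ f x := by
    have h := VectorFourier.integral_fourierIntegral_smul_eq_flip (μ := volume) (ν := volume)
      (L := -innerₗ ℝ) (f := (G : ℝ → ℂ)) (g := f) Real.continuous_fourierChar
      (continuous_inner (𝕜 := ℝ) (E := ℝ)).neg G.integrable hf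
    have e : (-innerₗ ℝ : ℝ →ₗ[ℝ] ℝ →ₗ[ℝ] ℝ).flip = -innerₗ ℝ := by
      ext; simp
    rw [e] at h
    exact h
  have hl : ∫ x : ℝ, (𝓕⁻ G) x • (hf2.toLp f) x = ∫ x : ℝ, (𝓕⁻ (G : ℝ → ℂ)) x • f x := by
    refine integral_congr_ae ?_
    filter_upwards [hf2.coeFn_toLp] with x hx
    rw [hx, SchwartzMap.fourierInv_coe]
  rw [hl, hflip] at key
  simpa [hG] using key.symm

/-- **Plancherel's theorem** for inverse Fourier integrals of functions in `L¹ ∩ L²`. -/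
theorem integral_fourierInv_mul_conj {f g : ℝ → ℂ} (hf : Integrable f) (hf2 : MemLp f 2)
    (hg : Integrable g) (hg2 : MemLp g 2) :
    ∫ x : ℝ, 𝓕⁻ f x * conj (𝓕⁻ g x) = ∫ x : ℝ, f x * conj (g x) := by
  have h : inner ℂ (𝓕⁻ (hg2.toLp g) : Lp ℂ 2 (volume : Measure ℝ)) (𝓕⁻ (hf2.toLp f))
      = inner ℂ (hg2.toLp g) (hf2.toLp f) :=
    (Lp.fourierTransformₗᵢ ℝ ℂ).symm.inner_map_map _ _
  rw [L2.inner_def, L2.inner_def] at h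
  refine Eq.trans (integral_congr_ae ?_) (h.trans (integral_congr_ae ?_))
  · filter_upwards [coeFn_fourierInv_toLp_ae_eq hf hf2, coeFn_fourierInv_toLp_ae_eq hg hg2]
      with x hx hy
    rw [hx, hy, RCLike.inner_apply]
  · filter_upwards [hf2.coeFn_toLp, hg2.coeFn_toLp] with x hx hy
    rw [hx, hy, RCLike.inner_apply]

/-- The Fourier transform of `psiJN p q m j n`, in the normalization `e^{-2πixξ}`. -/
def psiJNHat (p q m : ℕ) (j n : ℤ) (ξ : ℝ) : ℂ :=
  ((Mdil p q ^ ((j : ℝ) / 2) : ℝ) : ℂ) * (newHat q m (2 * π * Mdil p q ^ j * ξ) *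
    Complex.exp (-(Complex.I * ((2 * π * Mdil p q ^ j * ξ : ℝ) : ℂ) * ((n * q : ℝ) : ℂ))))

theorem measurable_newHat (q m : ℕ) : Measurable (newHat q m) := by
  unfold newHat
  refine Measurable.ite ?_ measurable_const measurable_const
  exact (measurableSet_le measurable_const measurable_norm).inter
    (measurableSet_lt measurable_norm measurable_const)

theorem norm_newHat_le (q m : ℕ) (ω : ℝ) : ‖newHat q m ω‖ ≤ √q := by
  unfold newHat
  split_ifs
  · simp [abs_of_nonneg]
  · simp

theorem newHat_eq_zero_of_lt {q m : ℕ} {ω : ℝ} (h : ((q : ℝ) + m) * π / q ≤ |ω|) :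
    newHat q m ω = 0 :=
  if_neg fun h' => absurd h'.2 (not_lt.2 h)

theorem Mdil_pos {p q : ℕ} (hq : 1 ≤ q) (hpq : q < p) : 0 < Mdil p q := by
  have : 0 < p := by omega
  unfold Mdil
  positivity

theorem memLp_psiJNHat {p q : ℕ} (hq : 1 ≤ q) (hpq : q < p) (m : ℕ) (j n : ℤ) (r : ENNReal) :
    MemLp (psiJNHat p q m j n) r := by
  have hM := Mdil_pos hq hpq
  set c := 2 * π * Mdil p q ^ j with hc
  have hcpos : 0 < c := by positivity
  set R := ((q : ℝ) + m) * π / q / c with hR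
  have hsupp : ∀ ξ ∉ Set.Icc (-R) R, psiJNHat p q m j n ξ = 0 := fun ξ hξ => by
    have : R < |ξ| := by
      rw [Set.mem_Icc, ← abs_le] at hξ
      exact not_le.1 hξ
    rw [hR, div_lt_iff₀ hcpos] at this
    rw [psiJNHat, newHat_eq_zero_of_lt, zero_mul, mul_zero]
    rw [← hc, abs_mul, abs_of_pos hcpos, mul_comm c]
    exact this.le
  have hmeas : Measurable (psiJNHat p q m j n) := by
    have := (measurable_newHat q m).comp (measurable_const_mul c)
    unfold psiJNHat
    exact measurable_const.mul (this.mul (by fun_prop))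
  have hbd (ξ : ℝ) : ‖psiJNHat p q m j n ξ‖ ≤ Mdil p q ^ ((j : ℝ) / 2) * √q := by
    have he : ‖Complex.exp (-(Complex.I * ((c * ξ : ℝ) : ℂ) * ((n * q : ℝ) : ℂ)))‖ = 1 := by
      rw [Complex.norm_exp]; simp
    rw [psiJNHat, norm_mul, norm_mul, he, mul_one, Complex.norm_real, Real.norm_eq_abs,
      abs_of_pos (by positivity)]
    gcongr
    exact norm_newHat_le _ _ _
  have hind : psiJNHat p q m j n = (Set.Icc (-R) R).indicator (psiJNHat p q m j n) := by
    ext ξ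
    by_cases hξ : ξ ∈ Set.Icc (-R) R
    · rw [Set.indicator_of_mem hξ]
    · rw [Set.indicator_of_notMem hξ, hsupp ξ hξ]
  rw [hind, memLp_indicator_iff_restrict measurableSet_Icc]
  exact MemLp.of_bound hmeas.aestronglyMeasurable _ (ae_of_all _ hbd)

theorem psiJN_eq_fourierInv {p q : ℕ} (hq : 1 ≤ q) (hpq : q < p) (m : ℕ) (j n : ℤ) :
    psiJN p q m j n = 𝓕⁻ (psiJNHat p q m j n) := by
  have hM := Mdil_pos hq hpq
  ext x
  set c := 2 * π * Mdil p q ^ j with hc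
  have hcpos : 0 < c := by positivity
  have hsub := Measure.integral_comp_mul_left (fun ω : ℝ => newHat q m ω *
    Complex.exp (Complex.I * (ω : ℂ) * ((Mdil p q ^ (-j) * x - n * q : ℝ) : ℂ))) c
  have hint : 𝓕⁻ (psiJNHat p q m j n) x = ((Mdil p q ^ ((j : ℝ) / 2) : ℝ) : ℂ) *
      ∫ ξ : ℝ, newHat q m (c * ξ) * Complex.exp (Complex.I * ((c * ξ : ℝ) : ℂ) *
        ((Mdil p q ^ (-j) * x - n * q : ℝ) : ℂ)) := by
    rw [Real.fourierInv_eq', ← integral_const_mul]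
    refine integral_congr_ae (ae_of_all _ fun ξ => ?_)
    have hexp : (((2 * π * inner ℝ ξ x : ℝ) : ℂ) * Complex.I) +
        -(Complex.I * ((c * ξ : ℝ) : ℂ) * ((n * q : ℝ) : ℂ)) =
        Complex.I * ((c * ξ : ℝ) : ℂ) * ((Mdil p q ^ (-j) * x - n * q : ℝ) : ℂ) := by
      have : c * ξ * (Mdil p q ^ (-j) * x) = 2 * π * (x * ξ) := by
        rw [hc, zpow_neg]
        field_simp
      have h2 : (2 * π * inner ℝ ξ x : ℝ) = c * ξ * (Mdil p q ^ (-j) * x) := by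
        rw [this]; simp
      rw [h2]
      push_cast
      ring
    simp only [psiJNHat, smul_eq_mul]
    rw [← hexp, Complex.exp_add]
    ring
  rw [hint, hsub]
  simp only [psiJN, dilTrans, newPsi, invFT, Complex.real_smul]
  rw [← mul_assoc, ← mul_assoc, ← Complex.ofReal_mul, ← Complex.ofReal_mul]
  congr 2
  rw [abs_of_pos (by positivity), hc, neg_div, Real.rpow_neg hM.le]
  have h : Mdil p q ^ j = Mdil p q ^ ((j : ℝ) / 2) * Mdil p q ^ ((j : ℝ) / 2) := by
    rw [← Real.rpow_add hM, add_halves, Real.rpow_intCast]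
  rw [h]
  have : 0 < Mdil p q ^ ((j : ℝ) / 2) := by positivity
  field_simp

/-- Distinct pairs (scale, channel) have disjoint frequency bands. -/
theorem newHat_mul_newHat_eq_zero {p q : ℕ} (hq : 1 ≤ q) (hpq : q < p) {j l : ℤ} {m₁ m₂ : ℕ}
    (hm₁ : 1 ≤ m₁) (hm₁' : m₁ ≤ p - q) (hm₂ : 1 ≤ m₂) (hm₂' : m₂ ≤ p - q)
    (hne : (j, m₁) ≠ (l, m₂)) (x : ℝ) :
    newHat q m₁ (Mdil p q ^ j * x) = 0 ∨ newHat q m₂ (Mdil p q ^ l * x) = 0 := by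
  wlog hjl : j ≤ l generalizing j l m₁ m₂
  · exact (this hm₂ hm₂' hm₁ hm₁' hne.symm (by omega)).symm
  have hM := Mdil_pos hq hpq
  have hq0 : (0 : ℝ) < q := by positivity
  have hM1 : 1 ≤ Mdil p q := by
    rw [Mdil, one_le_div hq0]
    exact_mod_cast hpq.le
  by_contra! h
  simp only [newHat, ne_eq, ite_eq_right_iff, not_forall] at h
  obtain ⟨⟨⟨a1, a2⟩, -⟩, ⟨⟨b1, b2⟩, -⟩⟩ := h
  rw [div_le_iff₀ hq0] at a1 b1
  rw [lt_div_iff₀ hq0] at a2 b2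
  have hm₁r : (1 : ℝ) ≤ m₁ := by exact_mod_cast hm₁
  have hm₂r : (q : ℝ) + m₂ ≤ p := by exact_mod_cast (by omega : q + m₂ ≤ p)
  rcases hjl.lt_or_eq with hlt | rfl
  · have hle : Mdil p q * Mdil p q ^ j ≤ Mdil p q ^ l := by
      rw [← zpow_one_add₀ hM.ne']
      exact zpow_le_zpow_right₀ hM1 (by omega)
    rw [abs_mul, abs_of_pos (by positivity)] at a1 b2
    have h1 : q * π ≤ Mdil p q ^ j * |x| * q := by nlinarith [Real.pi_pos]
    have h2 : Mdil p q * (Mdil p q ^ j * |x| * q) ≤ Mdil p q ^ l * |x| * q := by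
      calc _ = Mdil p q * Mdil p q ^ j * |x| * q := by ring
        _ ≤ _ := by gcongr
    have h3 : Mdil p q * (q * π) = p * π := by
      rw [Mdil]; field_simp
    have h4 := mul_le_mul_of_nonneg_left h1 hM.le
    have h5 : ((q : ℝ) + m₂) * π ≤ p * π := by gcongr
    linarith
  · have hmne : m₁ ≠ m₂ := fun h => hne (by rw [h])
    have h1 : ((q : ℝ) + m₁ - 1) < q + m₂ := lt_of_mul_lt_mul_right (a1.trans_lt b2) Real.pi_pos.le
    have h2 : ((q : ℝ) + m₂ - 1) < q + m₁ := lt_of_mul_lt_mul_right (b1.trans_lt a2) Real.pi_pos.le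
    have h1' : (m₁ : ℝ) < m₂ + 1 := by linarith
    have h2' : (m₂ : ℝ) < m₁ + 1 := by linarith
    norm_cast at h1' h2'
    omega

theorem integral_band_exp {q m : ℕ} (hq : 1 ≤ q) (hm : 1 ≤ m) (N : ℤ) :
    ∫ ω : ℝ, newHat q m ω * conj (newHat q m ω) *
      Complex.exp (-(Complex.I * N * q) * ω) = if N = 0 then 2 * (π : ℂ) else 0 := by
  have hq0 : (0 : ℝ) < q := by positivity
  have hqC : (q : ℂ) ≠ 0 := by exact_mod_cast hq0.ne'
  have hm1 : (1 : ℝ) ≤ m := by exact_mod_cast hm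
  set a : ℝ := ((q : ℝ) + m - 1) * π / q with ha
  set b : ℝ := ((q : ℝ) + m) * π / q with hb
  have ha0 : 0 < a := by
    have : 0 < (q : ℝ) + m - 1 := by linarith
    positivity
  have hab : b - a = π / q := by rw [ha, hb]; ring
  have hab' : a ≤ b := by
    have : 0 < π / q := by positivity
    linarith
  set F : ℝ → ℂ := fun ω => Complex.exp (-(Complex.I * N * q) * ω) with hF
  have hFc : Continuous F := by fun_prop
  have hset (ω : ℝ) : newHat q m ω * conj (newHat q m ω) * F ω =
      (Set.Ico a b ∪ Set.Ioc (-b) (-a)).indicator (fun ω => q * F ω) ω := by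
    have hmem : ω ∈ Set.Ico a b ∪ Set.Ioc (-b) (-a) ↔ a ≤ |ω| ∧ |ω| < b := by
      simp only [Set.mem_union, Set.mem_Ico, Set.mem_Ioc]
      rcases abs_cases ω with ⟨h, h'⟩ | ⟨h, h'⟩ <;> rw [h] <;> constructor
      · rintro (h | h)
        · exact h
        · constructor <;> linarith
      · exact fun h => Or.inl h
      · rintro (h | h) <;> constructor <;> linarith
      · exact fun h => Or.inr (by constructor <;> linarith)
    by_cases h : a ≤ |ω| ∧ |ω| < b
    · rw [Set.indicator_of_mem (hmem.2 h), newHat, if_pos h, Complex.conj_ofReal,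
        ← Complex.ofReal_mul, Real.mul_self_sqrt hq0.le, Complex.ofReal_natCast]
    · rw [Set.indicator_of_notMem (mt hmem.1 h), newHat, if_neg h, zero_mul, zero_mul]
  have hint (s t : ℝ) : IntegrableOn (fun ω => q * F ω) (Set.Ioc s t) :=
    ((continuous_const.mul hFc).integrableOn_Icc).mono_set Set.Ioc_subset_Icc_self
  have hdisj : Disjoint (Set.Ico a b) (Set.Ioc (-b) (-a)) := by
    rw [Set.disjoint_left]
    intro x hx hx'
    linarith [hx.1, hx'.2]
  rw [integral_congr_ae (ae_of_all _ hset), integral_indicator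
    (measurableSet_Ico.union measurableSet_Ioc), setIntegral_union hdisj measurableSet_Ioc
    ((hint a b).congr_set_ae Ico_ae_eq_Ioc) (hint _ _),
    integral_Ico_eq_integral_Ioc, ← intervalIntegral.integral_of_le hab',
    ← intervalIntegral.integral_of_le (neg_le_neg hab'),
    intervalIntegral.integral_const_mul, intervalIntegral.integral_const_mul]
  split_ifs with hN
  · have : F = fun _ => 1 := by
      ext ω
      simp [hF, hN]
    rw [this, intervalIntegral.integral_const, intervalIntegral.integral_const,
      show -a - -b = b - a by ring, hab]
    simp only [Complex.real_smul]
    push_cast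
    field_simp
    ring
  · set c : ℂ := -(Complex.I * N * q) with hc
    have hc0 : c ≠ 0 := by simp [hc, hN, hqC]
    have hper (K : ℤ) (r : ℝ) (hr : r * q = K * π) :
        Complex.exp (c * ((-r : ℝ) : ℂ)) = Complex.exp (c * (r : ℂ)) := by
      rw [Complex.exp_eq_exp_iff_exists_int]
      refine ⟨N * K, ?_⟩
      have hr' : (r : ℂ) * q = K * π := by exact_mod_cast hr
      rw [hc]
      push_cast
      linear_combination 2 * Complex.I * N * hr'
    have hpa := hper (q + m - 1) a (by rw [ha]; push_cast; field_simp)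
    have hpb := hper (q + m) b (by rw [hb]; push_cast; field_simp)
    rw [integral_exp_mul_complex hc0, integral_exp_mul_complex hc0, hpa, hpb]
    ring

/-- the new rational Littlewood–Paley wavelet family is orthonormal in `L²(ℝ)`. -/
theorem newPsi_orthonormal (p q : ℕ) (hco : Nat.Coprime p q)
    (hq : 1 ≤ q) (hpq : q < p) (j l n k : ℤ) (m₁ m₂ : ℕ)
    (hm₁ : 1 ≤ m₁) (hm₁' : m₁ ≤ p - q) (hm₂ : 1 ≤ m₂) (hm₂' : m₂ ≤ p - q) :
    innerL2 (psiJN p q m₁ j n) (psiJN p q m₂ l k)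
      = if (j, m₁, n) = (l, m₂, k) then 1 else 0 := by
  have hM := Mdil_pos hq hpq
  have hL1 (m : ℕ) (i r : ℤ) : Integrable (psiJNHat p q m i r) :=
    memLp_one_iff_integrable.1 (memLp_psiJNHat hq hpq m i r 1)
  rw [innerL2, psiJN_eq_fourierInv hq hpq, psiJN_eq_fourierInv hq hpq,
    integral_fourierInv_mul_conj (hL1 _ _ _) (memLp_psiJNHat hq hpq _ _ _ 2) (hL1 _ _ _)
      (memLp_psiJNHat hq hpq _ _ _ 2)]
  by_cases hjm : (j, m₁) = (l, m₂)
  · obtain ⟨rfl, rfl⟩ := Prod.mk.inj hjm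
    set c := 2 * π * Mdil p q ^ j with hc
    have hcpos : 0 < c := by positivity
    have hpt (ξ : ℝ) : psiJNHat p q m₁ j n ξ * conj (psiJNHat p q m₁ j k ξ) =
        ((Mdil p q ^ j : ℝ) : ℂ) * (newHat q m₁ (c * ξ) * conj (newHat q m₁ (c * ξ)) *
          Complex.exp (-(Complex.I * ((n - k : ℤ) : ℂ) * q) * ((c * ξ : ℝ) : ℂ))) := by
      have h : ((Mdil p q ^ j : ℝ) : ℂ) = ((Mdil p q ^ ((j : ℝ) / 2) : ℝ) : ℂ) *
          ((Mdil p q ^ ((j : ℝ) / 2) : ℝ) : ℂ) := by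
        rw [← Complex.ofReal_mul, ← Real.rpow_add hM, add_halves, Real.rpow_intCast]
      have he : -(Complex.I * ((n - k : ℤ) : ℂ) * q) * ((c * ξ : ℝ) : ℂ) =
          -(Complex.I * ((c * ξ : ℝ) : ℂ) * ((n * q : ℝ) : ℂ)) +
            Complex.I * ((c * ξ : ℝ) : ℂ) * ((k * q : ℝ) : ℂ) := by
        push_cast
        ring
      rw [he, Complex.exp_add, h]
      simp only [psiJNHat, ← hc, map_mul, Complex.conj_ofReal, ← Complex.exp_conj, map_neg,
        Complex.conj_I, neg_mul, neg_neg]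
      ring
    rw [integral_congr_ae (ae_of_all _ hpt), integral_const_mul,
      Measure.integral_comp_mul_left (fun ω : ℝ => newHat q m₁ ω * conj (newHat q m₁ ω) *
          Complex.exp (-(Complex.I * ((n - k : ℤ) : ℂ) * q) * (ω : ℂ))),
      integral_band_exp hq hm₁, abs_of_pos (by positivity)]
    by_cases hnk : n = k
    · rw [if_pos (by omega), if_pos (by rw [hnk]), Complex.real_smul, hc]
      have : ((Mdil p q : ℝ) : ℂ) ≠ 0 := by exact_mod_cast hM.ne'
      have hpi : (π : ℂ) ≠ 0 := by exact_mod_cast Real.pi_ne_zero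
      push_cast
      field_simp
    · rw [if_neg (by omega), if_neg (by simpa using hnk), smul_zero, mul_zero]
  · rw [if_neg fun h => hjm (by simp_all)]
    refine integral_eq_zero_of_ae (ae_of_all _ fun ξ => ?_)
    have hassoc (i : ℤ) : 2 * π * Mdil p q ^ i * ξ = Mdil p q ^ i * (2 * π * ξ) := by ring
    rcases newHat_mul_newHat_eq_zero hq hpq hm₁ hm₁' hm₂ hm₂' hjm (2 * π * ξ) with h | h <;>
      simp [psiJNHat, hassoc, h]
end
end
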